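/- arXiv:2309.12799 — 2 statements merged into one kernel-verified Lean document; each statement's English description precedes it below -/
import Mathlib

section
/- Free measure dominated by wired measure in finite volume: Let G = (V, E) be a finite connected graph, W ⊆ V nonempty with V∖W nonempty, and v₀ ∈ V. For each e ∈ E let ρ_e be a nonzero finite Borel measure on (0,∞) supported in [λ^{−1}, λ] for some λ ≥ 1, and ρ = ⊗_{e∈E}ρ_e. Let μ⁰ be the probability measure on (0,∞)^E with density proportional to (det L(κ)[V∖{v₀}])^{−1/2} w.r.t. ρ (free measure) and μ¹ be the probability measure with density proportional to (det L(κ)[V∖W])^{−1/2} w.r.t. ρ (wired measure obtained by contracting W). Then μ⁰ is stochastically dominated by μ¹: ∫ f dμ⁰ ≤ ∫ f dμ¹ for every bounded measurable increasing f : (0,∞)^E → ℝ. -/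
open MeasureTheory
open scoped Classical

/-- The weighted graph Laplacian of a finite graph `G` with conductances
`κ : Sym2 α → ℝ`. -/
noncomputable def glap {α : Type*} [Fintype α] (G : SimpleGraph α) (κ : Sym2 α → ℝ) :
    Matrix α α ℝ :=
  Matrix.of fun x y =>
    if x = y then ∑ z : α, (if G.Adj x z then κ s(x, z) else 0)
    else if G.Adj x y then -κ s(x, y) else 0

/-- The reduced determinant `det L(κ)[α∖W]`: for `W = {v₀}` the free reduced
determinant, for general `W` the reduced Laplacian determinant of the wired graph
obtained by identifying the vertices of `W`. -/
noncomputable def gdet {α : Type*} [Fintype α] (G : SimpleGraph α) (κ : Sym2 α → ℝ)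
    (W : Set α) : ℝ :=
  ((glap G κ).submatrix (fun x : {x : α // x ∉ W} => (x : α))
    (fun x : {x : α // x ∉ W} => (x : α))).det

/-- Extension of an edge-indexed conductance configuration to all of `Sym2 α`. -/
noncomputable def extendE {α : Type*} (G : SimpleGraph α) (c : G.edgeSet → ℝ) :
    Sym2 α → ℝ :=
  fun e => if h : e ∈ G.edgeSet then c ⟨e, h⟩ else 1

/-- Adding a rank one term `r • b bᵀ` to an invertible matrix multiplies its determinant by
`1 + r * bᵀ M⁻¹ b`. -/
lemma det_add_smul_vecMulVec_self {n : Type*} [Fintype n] [DecidableEq n] {M : Matrix n n ℝ}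
    (hM : IsUnit M.det) (r : ℝ) (b : n → ℝ) :
    (M + r • Matrix.vecMulVec b b).det = M.det * (1 + r * (b ⬝ᵥ (M⁻¹.mulVec b))) := by
  have h := Matrix.det_add_replicateCol_mul_replicateRow (ι := Unit) hM (r • b) b
  rw [← Matrix.vecMulVec_eq, Matrix.smul_vecMulVec] at h
  rw [h, Matrix.det_unique (n := Unit), Matrix.add_apply, Matrix.one_apply_eq, Matrix.mul_assoc,
    ← Matrix.replicateCol_mulVec, Matrix.replicateRow_mul_replicateCol_apply,
    Matrix.mulVec_smul, dotProduct_smul, smul_eq_mul]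

/-- Variational comparison of inverse quadratic forms: compressing a matrix and increasing it in
the Loewner order both decrease the inverse quadratic form. -/
lemma dotProduct_inv_compression_le {n m : Type*} [Fintype n] [DecidableEq n] [Fintype m]
    [DecidableEq m] {M N : Matrix n n ℝ} (hMN : (M - N).PosSemidef) (hN : N.PosDef)
    (P : Matrix n m ℝ) (hB : (P.transpose * M * P).PosDef) (b : n → ℝ) :
    (P.transpose.mulVec b) ⬝ᵥ ((P.transpose * M * P)⁻¹.mulVec (P.transpose.mulVec b)) ≤
      b ⬝ᵥ (N⁻¹.mulVec b) := by
  have hBu : IsUnit (P.transpose * M * P).det := hB.det_pos.ne'.isUnit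
  have hNu : IsUnit N.det := hN.det_pos.ne'.isUnit
  set u := (P.transpose * M * P)⁻¹.mulVec (P.transpose.mulVec b) with hu
  set v := N⁻¹.mulVec b with hv
  have e1 : (P.transpose * M * P).mulVec u = P.transpose.mulVec b := by
    rw [hu, Matrix.mulVec_mulVec, Matrix.mul_nonsing_inv _ hBu, Matrix.one_mulVec]
  have e2 : N.mulVec v = b := by
    rw [hv, Matrix.mulVec_mulVec, Matrix.mul_nonsing_inv _ hNu, Matrix.one_mulVec]
  set t := P.mulVec u with ht
  have tr (x : n → ℝ) : (P.transpose.mulVec x) ⬝ᵥ u = t ⬝ᵥ x := by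
    rw [Matrix.mulVec_transpose, ← Matrix.dotProduct_mulVec, dotProduct_comm]
  have e3 : t ⬝ᵥ M.mulVec t = t ⬝ᵥ b := by
    rw [← tr, ← tr, ← e1, ht, Matrix.mulVec_mulVec, Matrix.mulVec_mulVec, Matrix.mul_assoc]
  have h1 := hMN.dotProduct_mulVec_nonneg t
  have h2 := hN.posSemidef.dotProduct_mulVec_nonneg (v - t)
  have sym : v ⬝ᵥ N.mulVec t = t ⬝ᵥ b := by
    rw [Matrix.dotProduct_mulVec, ← Matrix.mulVec_transpose]
    have : N.transpose = N := by simpa using hN.isHermitian.eq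
    rw [this, e2, dotProduct_comm]
  simp only [star_trivial, Matrix.sub_mulVec, Matrix.mulVec_sub, dotProduct_sub, sub_dotProduct,
    e2, e3, sym] at h1 h2
  rw [tr, dotProduct_comm b v]
  linarith

lemma posSemidef_sum_smul_vecMulVec {n ι : Type*} [Fintype n] (s : Finset ι) {w : ι → ℝ}
    (hw : ∀ i, 0 ≤ w i) (b : ι → n → ℝ) :
    (∑ i ∈ s, w i • Matrix.vecMulVec (b i) (b i)).PosSemidef := by
  refine Matrix.posSemidef_sum s fun i _ => ?_
  have := Matrix.posSemidef_vecMulVec_self_star (b i)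
  simp only [star_trivial] at this
  exact this.smul (hw i)

/-- Adding the same nonnegative combination of rank one matrices increases the determinant of a
compression of `M` by a smaller factor than that of a smaller matrix `N ≤ M`. -/
lemma det_compression_add_mul_le {n m ι : Type*} [Fintype n] [DecidableEq n] [Fintype m]
    [DecidableEq m] {M N : Matrix n n ℝ} (hMN : (M - N).PosSemidef) (hN : N.PosDef)
    (P : Matrix n m ℝ) (hB : (P.transpose * M * P).PosDef) {w : ι → ℝ} (hw : ∀ i, 0 ≤ w i)
    (b : ι → n → ℝ) (s : Finset ι) :
    (P.transpose * (M + ∑ i ∈ s, w i • Matrix.vecMulVec (b i) (b i)) * P).det * N.det ≤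
      (N + ∑ i ∈ s, w i • Matrix.vecMulVec (b i) (b i)).det * (P.transpose * M * P).det := by
  induction s using Finset.induction_on with
  | empty => simp [mul_comm]
  | insert a s ha ih =>
    rw [Finset.sum_insert ha, add_comm (w a • _), ← add_assoc, ← add_assoc]
    set S := ∑ i ∈ s, w i • Matrix.vecMulVec (b i) (b i) with hS
    have hSp : S.PosSemidef := posSemidef_sum_smul_vecMulVec s hw b
    have hN' : (N + S).PosDef := hN.add_posSemidef hSp
    have hB' : (P.transpose * (M + S) * P).PosDef := by
      rw [Matrix.mul_add, Matrix.add_mul]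
      refine hB.add_posSemidef ?_
      simpa using hSp.conjTranspose_mul_mul_same P
    have hMN' : ((M + S) - (N + S)).PosSemidef := by simpa using hMN
    have key := dotProduct_inv_compression_le hMN' hN' P hB' (b a)
    have hcomp : P.transpose * (M + S + w a • Matrix.vecMulVec (b a) (b a)) * P =
        P.transpose * (M + S) * P +
          w a • Matrix.vecMulVec (P.transpose.mulVec (b a)) (P.transpose.mulVec (b a)) := by
      rw [Matrix.mul_add, Matrix.add_mul, Matrix.mul_smul, Matrix.smul_mul,
        Matrix.mul_vecMulVec, Matrix.vecMulVec_mul, Matrix.mulVec_transpose]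
    rw [hcomp, det_add_smul_vecMulVec_self hB'.det_pos.ne'.isUnit,
      det_add_smul_vecMulVec_self hN'.det_pos.ne'.isUnit]
    have hq : 0 ≤ (P.transpose.mulVec (b a)) ⬝ᵥ
        ((P.transpose * (M + S) * P)⁻¹.mulVec (P.transpose.mulVec (b a))) := by
      simpa using hB'.inv.posSemidef.dotProduct_mulVec_nonneg (P.transpose.mulVec (b a))
    set q := (P.transpose.mulVec (b a)) ⬝ᵥ
        ((P.transpose * (M + S) * P)⁻¹.mulVec (P.transpose.mulVec (b a)))
    set q' := b a ⬝ᵥ ((N + S)⁻¹.mulVec (b a))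
    have hwa := hw a
    have hle : 1 + w a * q ≤ 1 + w a * q' := by gcongr
    calc (P.transpose * (M + S) * P).det * (1 + w a * q) * N.det
        = ((P.transpose * (M + S) * P).det * N.det) * (1 + w a * q) := by ring
      _ ≤ ((N + S).det * (P.transpose * M * P).det) * (1 + w a * q') :=
        mul_le_mul ih hle (by positivity) (mul_nonneg hN'.det_pos.le hB.det_pos.le)
      _ = _ := by ring

/-- The one-dimensional four functions theorem for Lebesgue integrals over a linear order. -/
lemma lintegral_mul_lintegral_le_of_four_functions {α : Type*} [LinearOrder α]
    [MeasurableSpace α] (μ : Measure α) {f₁ f₂ f₃ f₄ : α → ENNReal} (h₁ : Measurable f₁)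
    (h₂ : Measurable f₂) (h₃ : Measurable f₃) (h₄ : Measurable f₄)
    (h : ∀ x y, f₁ x * f₂ y ≤ f₃ (x ⊔ y) * f₄ (x ⊓ y)) :
    (∫⁻ x, f₁ x ∂μ) * (∫⁻ x, f₂ x ∂μ) ≤ (∫⁻ x, f₃ x ∂μ) * (∫⁻ x, f₄ x ∂μ) := by
  have real_aux (a b c d : ℝ) (ha : 0 ≤ a) (hb : 0 ≤ b) (hc : 0 < c) (hac : a ≤ c)
      (hbc : b ≤ c) (habcd : a * b ≤ c * d) : a + b ≤ c + d := by
    nlinarith [mul_nonneg (sub_nonneg.2 hac) (sub_nonneg.2 hbc)]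
  have aux (a b c d : ENNReal) (hac : a ≤ c) (hbc : b ≤ c) (habcd : a * b ≤ c * d) :
      a + b ≤ c + d := by
    rcases eq_or_ne c ⊤ with rfl | hc
    · simp
    rcases eq_or_ne d ⊤ with rfl | hd
    · simp
    rcases eq_or_ne c 0 with rfl | hc0
    · simp_all
    have ha := ne_top_of_le_ne_top hc hac
    have hb := ne_top_of_le_ne_top hc hbc
    lift a to NNReal using ha
    lift b to NNReal using hb
    lift c to NNReal using hc
    lift d to NNReal using hd
    norm_cast at *
    exact real_aux a b c d a.2 b.2 (by positivity) hac hbc (by exact_mod_cast habcd)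
  have pt_of_le (x y : α) (hxy : x ≤ y) :
      f₁ x * f₂ y + f₁ y * f₂ x ≤ f₃ x * f₄ y + f₃ y * f₄ x := by
    rw [add_comm (f₃ x * f₄ y)]
    have hx := h x x
    have hy := h y y
    have hxy' := h x y
    have hyx := h y x
    simp only [sup_idem, inf_idem, sup_of_le_right hxy, inf_of_le_left hxy,
      sup_of_le_left hxy, inf_of_le_right hxy] at hx hy hxy' hyx
    refine aux _ _ _ _ hxy' hyx ?_
    calc _ = (f₁ x * f₂ x) * (f₁ y * f₂ y) := by ring
      _ ≤ (f₃ x * f₄ x) * (f₃ y * f₄ y) := by gcongr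
      _ = _ := by ring
  have pt (x y : α) : f₁ x * f₂ y + f₁ y * f₂ x ≤ f₃ x * f₄ y + f₃ y * f₄ x := by
    rcases le_total x y with hxy | hxy
    · exact pt_of_le x y hxy
    · rw [add_comm, add_comm (f₃ x * f₄ y)]
      exact pt_of_le y x hxy
  have double (f g : α → ENNReal) (hf : Measurable f) (hg : Measurable g) :
      ∫⁻ x, ∫⁻ y, (f x * g y + f y * g x) ∂μ ∂μ =
        2 * ((∫⁻ x, f x ∂μ) * (∫⁻ x, g x ∂μ)) := by
    have inner (x : α) : ∫⁻ y, (f x * g y + f y * g x) ∂μ =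
        f x * (∫⁻ y, g y ∂μ) + (∫⁻ y, f y ∂μ) * g x := by
      rw [lintegral_add_left (hg.const_mul _), lintegral_const_mul _ hg,
        lintegral_mul_const _ hf]
    simp_rw [inner]
    rw [lintegral_add_left (hf.mul_const _), lintegral_mul_const _ hf,
      lintegral_const_mul _ hg, two_mul]
  have key := lintegral_mono (μ := μ) fun x => lintegral_mono (μ := μ) (pt x)
  rw [double f₁ f₂ h₁ h₂, double f₃ f₄ h₃ h₄] at key
  exact (ENNReal.mul_le_mul_iff_right (by norm_num) (by norm_num)).1 key

/-- The four functions theorem for product measures. -/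
lemma lintegral_pi_mul_le_of_four_functions {ι : Type*} [Fintype ι] (ρ : ι → Measure ℝ)
    [∀ i, SigmaFinite (ρ i)] {f₁ f₂ f₃ f₄ : (ι → ℝ) → ENNReal} (h₁ : Measurable f₁)
    (h₂ : Measurable f₂) (h₃ : Measurable f₃) (h₄ : Measurable f₄)
    (h : ∀ x y, f₁ x * f₂ y ≤ f₃ (x ⊔ y) * f₄ (x ⊓ y)) :
    (∫⁻ x, f₁ x ∂Measure.pi ρ) * (∫⁻ x, f₂ x ∂Measure.pi ρ) ≤
      (∫⁻ x, f₃ x ∂Measure.pi ρ) * (∫⁻ x, f₄ x ∂Measure.pi ρ) := by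
  have main (s : Finset ι) : ∀ x y, lmarginal ρ s f₁ x * lmarginal ρ s f₂ y ≤
      lmarginal ρ s f₃ (x ⊔ y) * lmarginal ρ s f₄ (x ⊓ y) := by
    induction s using Finset.induction_on with
    | empty => simpa using h
    | insert i s hi ih =>
      intro x y
      rw [lmarginal_insert _ h₁ hi, lmarginal_insert _ h₂ hi, lmarginal_insert _ h₃ hi,
        lmarginal_insert _ h₄ hi]
      refine lintegral_mul_lintegral_le_of_four_functions (ρ i)
        ((h₁.lmarginal ρ).comp (measurable_update x)) ((h₂.lmarginal ρ).comp (measurable_update y))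
        ((h₃.lmarginal ρ).comp (measurable_update _)) ((h₄.lmarginal ρ).comp (measurable_update _))
        fun a b => ?_
      have hsup : Function.update x i a ⊔ Function.update y i b =
          Function.update (x ⊔ y) i (a ⊔ b) := by
        ext j
        by_cases hj : j = i
        · subst hj; simp
        · simp [hj]
      have hinf : Function.update x i a ⊓ Function.update y i b =
          Function.update (x ⊓ y) i (a ⊓ b) := by
        ext j
        by_cases hj : j = i
        · subst hj; simp
        · simp [hj]
      rw [← hsup, ← hinf]
      exact ih _ _
  simpa using main Finset.univ 0 0

lemma glap_add {α : Type*} [Fintype α] (G : SimpleGraph α) (κ δ : Sym2 α → ℝ) :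
    glap G (κ + δ) = glap G κ + glap G δ := by
  ext x y
  simp only [glap, Matrix.of_apply, Matrix.add_apply, Pi.add_apply]
  split_ifs with h h'
  · rw [← Finset.sum_add_distrib]
    exact Finset.sum_congr rfl fun z _ => by split_ifs <;> simp
  · ring
  · simp

/-- The Laplacian as a sum of rank one matrices over ordered pairs of vertices. -/
lemma glap_eq_sum_vecMulVec {α : Type*} [Fintype α] (G : SimpleGraph α) (κ : Sym2 α → ℝ) :
    glap G κ = ∑ p : α × α, (if G.Adj p.1 p.2 then κ s(p.1, p.2) / 2 else 0) •
      Matrix.vecMulVec (Pi.single p.1 1 - Pi.single p.2 1) (Pi.single p.1 1 - Pi.single p.2 1) := by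
  ext i j
  rw [Matrix.sum_apply, Fintype.sum_prod_type]
  set w : α → α → ℝ := fun x y => if G.Adj x y then κ s(x, y) / 2 else 0 with hw
  have hsymm (x y : α) : w x y = w y x := by simp [hw, G.adj_comm x y, Sym2.eq_swap]
  have hloop (x : α) : w x x = 0 := by simp [hw]
  have hdiag : glap G κ i j = if i = j then 2 * ∑ z, w i z else -(2 * w i j) := by
    simp only [glap, Matrix.of_apply, hw, Finset.mul_sum, mul_ite, mul_zero]
    split_ifs <;> ring_nf
  have hterm : ∀ x y, ((if G.Adj x y then κ s(x, y) / 2 else 0) •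
      Matrix.vecMulVec (Pi.single x 1 - Pi.single y 1 : α → ℝ)
        (Pi.single x 1 - Pi.single y 1)) i j =
      (if i = x then (if j = x then w x y else 0) else 0)
        - (if i = x then (if j = y then w x y else 0) else 0)
        - (if i = y then (if j = x then w x y else 0) else 0)
        + (if i = y then (if j = y then w x y else 0) else 0) := by
    intro x y
    simp only [Matrix.smul_apply, Matrix.vecMulVec_apply, Pi.sub_apply, Pi.single_apply,
      smul_eq_mul, hw]
    split_ifs <;> simp
  simp only [hterm, Finset.sum_add_distrib, Finset.sum_sub_distrib, Finset.sum_ite_eq,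
    Finset.mem_univ, if_true, hdiag]
  have h1 : ∀ x, ∑ y, (if i = x then (if j = x then w x y else 0) else 0) =
      if i = x then (if j = x then ∑ y, w x y else 0) else 0 := by
    intro x; split_ifs <;> simp
  have h2 : ∀ x, ∑ y, (if i = x then (if j = y then w x y else 0) else 0) =
      if i = x then w x j else 0 := by
    intro x; split_ifs <;> simp
  simp only [h1, h2, Finset.sum_ite_eq, Finset.mem_univ, if_true]
  by_cases hij : i = j
  · subst hij
    simp only [if_true, hloop]
    simp only [hsymm _ i]
    ring
  · simp [hij, Ne.symm hij, hsymm j i]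
    ring

lemma glap_isSymm {α : Type*} [Fintype α] (G : SimpleGraph α) (κ : Sym2 α → ℝ) :
    (glap G κ).transpose = glap G κ := by
  rw [glap_eq_sum_vecMulVec]
  simp only [Matrix.transpose_sum, Matrix.transpose_smul, Matrix.transpose_vecMulVec]

lemma glap_mulVec_one {α : Type*} [Fintype α] (G : SimpleGraph α) (κ : Sym2 α → ℝ) :
    (glap G κ).mulVec 1 = 0 := by
  rw [glap_eq_sum_vecMulVec, Matrix.sum_mulVec]
  refine Finset.sum_eq_zero fun p _ => ?_
  rw [Matrix.smul_mulVec, Matrix.vecMulVec_mulVec]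
  simp [sub_dotProduct]

/-- The Dirichlet form of the Laplacian. -/
lemma dotProduct_glap_mulVec {α : Type*} [Fintype α] (G : SimpleGraph α) (κ : Sym2 α → ℝ)
    (u : α → ℝ) : u ⬝ᵥ (glap G κ).mulVec u =
      ∑ p : α × α, (if G.Adj p.1 p.2 then κ s(p.1, p.2) / 2 else 0) * (u p.1 - u p.2) ^ 2 := by
  rw [glap_eq_sum_vecMulVec, Matrix.sum_mulVec, dotProduct_sum]
  refine Finset.sum_congr rfl fun p _ => ?_
  rw [Matrix.smul_mulVec, Matrix.vecMulVec_mulVec, dotProduct_smul, op_smul_eq_smul,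
    dotProduct_smul, sub_dotProduct, dotProduct_sub]
  simp only [single_one_dotProduct, dotProduct_single_one, smul_eq_mul, sq]

lemma half_conductance_nonneg {α : Type*} {G : SimpleGraph α} {κ : Sym2 α → ℝ}
    (hκ : ∀ e ∈ G.edgeSet, 0 ≤ κ e) (p : α × α) :
    0 ≤ if G.Adj p.1 p.2 then κ s(p.1, p.2) / 2 else 0 := by
  split_ifs with h
  · exact div_nonneg (hκ _ h) zero_le_two
  · exact le_rfl

lemma glap_posSemidef {α : Type*} [Fintype α] {G : SimpleGraph α} {κ : Sym2 α → ℝ}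
    (hκ : ∀ e ∈ G.edgeSet, 0 ≤ κ e) : (glap G κ).PosSemidef := by
  rw [glap_eq_sum_vecMulVec]
  exact posSemidef_sum_smul_vecMulVec _ (half_conductance_nonneg hκ) _

/-- On a connected graph, a function with zero Dirichlet energy is constant. -/
lemma eq_of_dotProduct_glap_mulVec_eq_zero {α : Type*} [Fintype α] {G : SimpleGraph α}
    (hconn : G.Connected) {κ : Sym2 α → ℝ} (hκ : ∀ e ∈ G.edgeSet, 0 < κ e) {u : α → ℝ}
    (hu : u ⬝ᵥ (glap G κ).mulVec u = 0) (x y : α) : u x = u y := by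
  rw [dotProduct_glap_mulVec, Finset.sum_eq_zero_iff_of_nonneg fun p _ =>
    mul_nonneg (half_conductance_nonneg (fun e he => (hκ e he).le) p) (sq_nonneg _)] at hu
  have hadj (a b : α) (hab : G.Adj a b) : u a = u b := by
    have := hu (a, b) (Finset.mem_univ _)
    have hpos := hκ s(a, b) hab
    simp only [hab, if_true, mul_eq_zero, pow_eq_zero_iff, ne_eq, OfNat.ofNat_ne_zero,
      not_false_eq_true] at this
    rcases this with h | h <;> linarith
  obtain ⟨p⟩ := hconn.preconnected x y
  induction p with
  | nil => rfl
  | cons h _ ih => exact (hadj _ _ h).trans ih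

lemma glap_submatrix_posDef {α : Type*} [Fintype α] {G : SimpleGraph α} (hconn : G.Connected)
    {κ : Sym2 α → ℝ} (hκ : ∀ e ∈ G.edgeSet, 0 < κ e) {W : Set α} (hW : W.Nonempty) :
    ((glap G κ).submatrix (fun x : {x : α // x ∉ W} => (x : α))
      (fun x : {x : α // x ∉ W} => (x : α))).PosDef := by
  obtain ⟨w, hw⟩ := hW
  have hS := glap_posSemidef (G := G) fun e he => (hκ e he).le
  refine Matrix.PosDef.of_dotProduct_mulVec_pos (hS.isHermitian.submatrix _) fun u hu => ?_
  set t : α → ℝ := fun x => if h : x ∉ W then u ⟨x, h⟩ else 0 with ht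
  have hsum (g : α → ℝ) : ∑ x, t x * g x = ∑ x : {x : α // x ∉ W}, u x * g x := by
    have hmem (x : α) : x ∈ Finset.univ.filter (· ∉ W) ↔ x ∉ W := by simp
    have hrestrict : ∑ x : {x : α // x ∉ W}, u x * g x =
        ∑ x : {x : α // x ∉ W}, t x * g x :=
      Finset.sum_congr rfl fun x _ => by simp [ht, x.2]
    rw [hrestrict, ← Finset.sum_subtype _ hmem fun x => t x * g x, Finset.sum_filter]
    refine Finset.sum_congr rfl fun x _ => ?_
    by_cases hx : x ∈ W <;> simp [ht, hx]
  have hform : star u ⬝ᵥ ((glap G κ).submatrix (fun x : {x : α // x ∉ W} => (x : α))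
      (fun x : {x : α // x ∉ W} => (x : α))).mulVec u = t ⬝ᵥ (glap G κ).mulVec t := by
    simp only [star_trivial, dotProduct, Matrix.mulVec, Matrix.submatrix_apply]
    rw [hsum]
    refine Finset.sum_congr rfl fun x _ => ?_
    congr 1
    simp_rw [mul_comm (glap G κ _ _)]
    rw [hsum]
  rw [hform]
  refine lt_of_le_of_ne (by simpa using hS.dotProduct_mulVec_nonneg t) fun h0 => hu ?_
  ext x
  have hx := eq_of_dotProduct_glap_mulVec_eq_zero hconn hκ h0.symm x w
  simpa [ht, hw, x.2] using hx

lemma gdet_pos {α : Type*} [Fintype α] {G : SimpleGraph α} (hconn : G.Connected)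
    {κ : Sym2 α → ℝ} (hκ : ∀ e ∈ G.edgeSet, 0 < κ e) {W : Set α} (hW : W.Nonempty) :
    0 < gdet G κ W :=
  (glap_submatrix_posDef hconn hκ hW).det_pos

lemma gdet_singleton_eq_adjugate {α : Type*} [Fintype α] (G : SimpleGraph α) (κ : Sym2 α → ℝ)
    (v : α) : gdet G κ {v} = (glap G κ).adjugate v v := by
  rw [Matrix.adjugate_apply,
    Matrix.twoBlockTriangular_det _ (fun x => x ∉ ({v} : Set α)) ?_]
  · have h2 : (Matrix.toSquareBlockProp ((glap G κ).updateRow v (Pi.single v 1))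
        (fun x => ¬ x ∉ ({v} : Set α))).det = 1 := by
      have : Matrix.toSquareBlockProp ((glap G κ).updateRow v (Pi.single v 1))
        (fun x => ¬ x ∉ ({v} : Set α)) = 1 := by
        ext ⟨i, hi⟩ ⟨j, hj⟩
        simp only [Set.mem_singleton_iff, not_not] at hi hj
        subst hi hj
        simp [Matrix.toSquareBlockProp]
      rw [this, Matrix.det_one]
    rw [h2, mul_one, gdet]
    congr 1
    ext ⟨i, hi⟩ ⟨j, hj⟩
    have : i ≠ v := hi
    simp [Matrix.toSquareBlockProp, this]
  · intro i hi j hj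
    simp only [Set.mem_singleton_iff, not_not] at hi hj
    subst hi
    simp [hj]

/-- The free reduced determinant does not depend on the removed vertex. -/
lemma gdet_singleton_eq {α : Type*} [Fintype α] {G : SimpleGraph α} (hconn : G.Connected)
    {κ : Sym2 α → ℝ} (hκ : ∀ e ∈ G.edgeSet, 0 < κ e) (v w : α) :
    gdet G κ {v} = gdet G κ {w} := by
  have hdet : (glap G κ).det = 0 :=
    Matrix.exists_mulVec_eq_zero_iff.1 ⟨1, fun h => by simpa using congrFun h v,
      glap_mulVec_one G κ⟩
  have hcol (j x y : α) : (glap G κ).adjugate x j = (glap G κ).adjugate y j := by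
    refine eq_of_dotProduct_glap_mulVec_eq_zero (u := fun i => (glap G κ).adjugate i j)
      hconn hκ ?_ x y
    have : (glap G κ).mulVec (fun i => (glap G κ).adjugate i j) = 0 := by
      have h := (glap G κ).mul_adjugate
      rw [hdet, zero_smul] at h
      ext i
      exact congrFun (congrFun h i) j
    rw [this, dotProduct_zero]
  have hsymm (i j : α) : (glap G κ).adjugate i j = (glap G κ).adjugate j i := by
    have := Matrix.adjugate_transpose (glap G κ)
    rw [glap_isSymm] at this
    exact congrFun (congrFun this j) i
  rw [gdet_singleton_eq_adjugate, gdet_singleton_eq_adjugate, hcol v v w, hsymm w v,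
    hcol w v w]

/-- Increasing the conductances by `δ` increases the wired determinant at `κ' ≥ κ` by a smaller
factor than the free determinant at `κ`. -/
lemma gdet_add_mul_gdet_le {α : Type*} [Fintype α] {G : SimpleGraph α} (hconn : G.Connected)
    {κ κ' δ : Sym2 α → ℝ} (hκ : ∀ e ∈ G.edgeSet, 0 < κ e) (hκκ' : ∀ e ∈ G.edgeSet, κ e ≤ κ' e)
    (hδ : ∀ e ∈ G.edgeSet, 0 ≤ δ e) {W : Set α} (hW : W.Nonempty) (v : α) :
    gdet G (κ' + δ) W * gdet G κ {v} ≤ gdet G (κ + δ) {v} * gdet G κ' W := by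
  obtain ⟨w, hw⟩ := hW
  rw [gdet_singleton_eq hconn hκ v w,
    gdet_singleton_eq hconn (κ := κ + δ)
      (fun e he => add_pos_of_pos_of_nonneg (hκ e he) (hδ e he)) v w]
  let val : {x : α // x ∉ ({w} : Set α)} → α := fun x => x
  let j : {x : α // x ∉ W} → {x : α // x ∉ ({w} : Set α)} :=
    fun x => ⟨x, fun h => x.2 (by rw [Set.mem_singleton_iff.1 h]; exact hw)⟩
  let P := (1 : Matrix {x : α // x ∉ ({w} : Set α)} {x : α // x ∉ ({w} : Set α)} ℝ).submatrix id j
  have hP (M : Matrix {x : α // x ∉ ({w} : Set α)} {x : α // x ∉ ({w} : Set α)} ℝ) :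
      P.transpose * M * P = M.submatrix j j := by
    ext a b
    simp [P, Matrix.mul_apply, Matrix.one_apply]
  have hsub : (glap G κ').submatrix val val - (glap G κ).submatrix val val =
      (glap G (κ' - κ)).submatrix val val := by
    rw [show glap G κ' = glap G (κ + (κ' - κ)) by rw [add_sub_cancel], glap_add,
      Matrix.submatrix_add]
    simp
  have hδsum : (glap G δ).submatrix val val =
      ∑ p : α × α, (if G.Adj p.1 p.2 then δ s(p.1, p.2) / 2 else 0) •
        Matrix.vecMulVec ((Pi.single p.1 1 - Pi.single p.2 1 : α → ℝ) ∘ val)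
          ((Pi.single p.1 1 - Pi.single p.2 1 : α → ℝ) ∘ val) := by
    rw [glap_eq_sum_vecMulVec]
    ext a b
    simp only [Matrix.submatrix_apply, Matrix.sum_apply, Matrix.smul_apply,
      Matrix.vecMulVec_apply, Function.comp_apply]
  have hpsd : (glap G (κ' - κ)).PosSemidef :=
    glap_posSemidef fun e he => sub_nonneg.2 (hκκ' e he)
  have hκ' : ∀ e ∈ G.edgeSet, 0 < κ' e := fun e he => (hκ e he).trans_le (hκκ' e he)
  have key := det_compression_add_mul_le (M := (glap G κ').submatrix val val)
    (N := (glap G κ).submatrix val val) (by rw [hsub]; exact hpsd.submatrix val)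
    (glap_submatrix_posDef hconn hκ ⟨w, rfl⟩) P
    (by rw [hP]; exact glap_submatrix_posDef hconn hκ' ⟨w, hw⟩)
    (half_conductance_nonneg hδ)
    (fun p => (Pi.single p.1 1 - Pi.single p.2 1 : α → ℝ) ∘ val) Finset.univ
  rw [← hδsum, hP, hP] at key
  rw [gdet, gdet, gdet, gdet, glap_add, glap_add]
  exact key

/-- The Holley condition for the free and wired determinants. -/
lemma gdet_inf_mul_gdet_sup_le {α : Type*} [Fintype α] {G : SimpleGraph α}
    (hconn : G.Connected) {c d : G.edgeSet → ℝ} (hc : ∀ e, 0 < c e) (hd : ∀ e, 0 < d e)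
    {W : Set α} (hW : W.Nonempty) (v : α) :
    gdet G (extendE G (c ⊔ d)) W * gdet G (extendE G (c ⊓ d)) {v} ≤
      gdet G (extendE G c) {v} * gdet G (extendE G d) W := by
  have h := gdet_add_mul_gdet_le hconn (κ := extendE G (c ⊓ d)) (κ' := extendE G d)
    (δ := extendE G c - extendE G (c ⊓ d))
    (fun e he => by simp [extendE, he, hc, hd]) (fun e he => by simp [extendE, he])
    (fun e he => by simp [extendE, he]) hW v
  have hsup : extendE G d + (extendE G c - extendE G (c ⊓ d)) = extendE G (c ⊔ d) := by
    ext e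
    by_cases he : e ∈ G.edgeSet
    · have := max_add_min (c ⟨e, he⟩) (d ⟨e, he⟩)
      simp only [extendE, he, Pi.add_apply, Pi.sub_apply, dite_true, Pi.inf_apply, Pi.sup_apply]
      linarith
    · simp [extendE, he]
  rwa [hsup, add_sub_cancel] at h

lemma extendE_pos {α : Type*} {G : SimpleGraph α} {c : G.edgeSet → ℝ} (hc : ∀ e, 0 < c e) :
    ∀ e ∈ G.edgeSet, 0 < extendE G c e := fun e he => by simp [extendE, he, hc]

lemma continuous_gdet_extendE {α : Type*} [Fintype α] (G : SimpleGraph α) (W : Set α) :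
    Continuous fun c : G.edgeSet → ℝ => gdet G (extendE G c) W := by
  have hext (e : Sym2 α) : Continuous fun c : G.edgeSet → ℝ => extendE G c e := by
    unfold extendE
    split_ifs with h
    · exact continuous_apply _
    · exact continuous_const
  refine Continuous.matrix_det (continuous_matrix fun i j => ?_)
  simp only [Matrix.submatrix_apply, glap, Matrix.of_apply]
  split_ifs
  · refine continuous_finsetSum _ fun z _ => ?_
    split_ifs
    · exact hext _
    · exact continuous_const
  · exact (hext _).neg
  · exact continuous_const

/-- Holley's criterion for densities with respect to a finite product measure concentrated on
the measurable sublattice `B`. -/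
lemma integral_withDensity_le_of_holley {ι : Type*} [Fintype ι] (ρ : ι → Measure ℝ)
    [∀ i, SigmaFinite (ρ i)] {B : Set (ι → ℝ)} (hB : MeasurableSet B)
    (hBae : ∀ᵐ x ∂Measure.pi ρ, x ∈ B)
    (hBsup : ∀ x ∈ B, ∀ y ∈ B, x ⊔ y ∈ B) (hBinf : ∀ x ∈ B, ∀ y ∈ B, x ⊓ y ∈ B)
    {g₀ g₁ : (ι → ℝ) → ENNReal} (hg₀ : Measurable g₀) (hg₁ : Measurable g₁)
    [IsProbabilityMeasure ((Measure.pi ρ).withDensity g₀)]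
    [IsProbabilityMeasure ((Measure.pi ρ).withDensity g₁)]
    (hholley : ∀ x ∈ B, ∀ y ∈ B, g₀ x * g₁ y ≤ g₁ (x ⊔ y) * g₀ (x ⊓ y))
    {f : (ι → ℝ) → ℝ} (hf : Measurable f) (hfbdd : ∃ C : ℝ, ∀ x, |f x| ≤ C)
    (hfmono : ∀ x ∈ B, ∀ y ∈ B, x ≤ y → f x ≤ f y) :
    ∫ x, f x ∂(Measure.pi ρ).withDensity g₀ ≤ ∫ x, f x ∂(Measure.pi ρ).withDensity g₁ := by
  obtain ⟨C, hC⟩ := hfbdd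
  set F : (ι → ℝ) → ENNReal := fun x => ENNReal.ofReal (f x + C) with hF
  have hFm : Measurable F := (hf.add_const C).ennreal_ofReal
  have hind (g : (ι → ℝ) → ENNReal) :
      ∫⁻ x, g x ∂Measure.pi ρ = ∫⁻ x, B.indicator g x ∂Measure.pi ρ := by
    refine lintegral_congr_ae ?_
    filter_upwards [hBae] with x hx
    rw [Set.indicator_of_mem hx]
  have hmass (g : (ι → ℝ) → ENNReal) (hg : IsProbabilityMeasure ((Measure.pi ρ).withDensity g)) :
      ∫⁻ x, B.indicator g x ∂Measure.pi ρ = 1 := by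
    rw [← hind, ← setLIntegral_univ, ← withDensity_apply _ MeasurableSet.univ]
    exact hg.measure_univ
  have key := lintegral_pi_mul_le_of_four_functions ρ (f₁ := B.indicator (g₀ * F))
    (f₂ := B.indicator g₁) (f₃ := B.indicator (g₁ * F)) (f₄ := B.indicator g₀)
    ((hg₀.mul hFm).indicator hB) (hg₁.indicator hB) ((hg₁.mul hFm).indicator hB)
    (hg₀.indicator hB) fun x y => by
      by_cases hx : x ∈ B
      · by_cases hy : y ∈ B
        · rw [Set.indicator_of_mem hx, Set.indicator_of_mem hy,
            Set.indicator_of_mem (hBsup x hx y hy), Set.indicator_of_mem (hBinf x hx y hy),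
            Pi.mul_apply, Pi.mul_apply, mul_right_comm, mul_right_comm (g₁ _)]
          have hle : F x ≤ F (x ⊔ y) := by
            have := hfmono x hx _ (hBsup x hx y hy) le_sup_left
            simp only [hF]
            gcongr
          exact mul_le_mul' (hholley x hx y hy) hle
        · simp [hy]
      · simp [hx]
  rw [hmass g₀ inferInstance, hmass g₁ inferInstance, mul_one, mul_one, ← hind, ← hind,
    ← lintegral_withDensity_eq_lintegral_mul _ hg₀ hFm,
    ← lintegral_withDensity_eq_lintegral_mul _ hg₁ hFm] at key
  have hint (μ : Measure (ι → ℝ)) [IsProbabilityMeasure μ] : Integrable f μ :=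
    Integrable.of_bound hf.aestronglyMeasurable C (Filter.Eventually.of_forall hC)
  have hnn (x : ι → ℝ) : 0 ≤ f x + C := by linarith [neg_abs_le (f x), hC x]
  have hshift (μ : Measure (ι → ℝ)) [IsProbabilityMeasure μ] :
      ENNReal.ofReal (∫ x, f x ∂μ + C) = ∫⁻ x, F x ∂μ := by
    have hadd : Integrable (fun x => f x + C) μ := (hint μ).add (integrable_const C)
    rw [hF, ← ofReal_integral_eq_lintegral_ofReal hadd (Filter.Eventually.of_forall hnn),
      integral_add (hint μ) (integrable_const C)]
    simp
  rw [← hshift, ← hshift] at key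
  have hpos : 0 ≤ ∫ x, f x ∂(Measure.pi ρ).withDensity g₁ + C := by
    have : 0 ≤ ∫ x, (f x + C) ∂(Measure.pi ρ).withDensity g₁ := integral_nonneg hnn
    rw [integral_add (hint _) (integrable_const C)] at this
    simpa using this
  linarith [(ENNReal.ofReal_le_ofReal_iff hpos).1 key]

/-- **Free measure dominated by wired measure in finite volume**:
the free measure `μ⁰` (density `∝ (det L(κ)[V∖{v₀}])^{-1/2}`) is stochastically
dominated by the wired measure `μ¹` (density `∝ (det L(κ)[V∖W])^{-1/2}`). -/
theorem free_dominated_by_wired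
    {V : Type*} [Fintype V] (G : SimpleGraph V) (hconn : G.Connected)
    (W : Set V) (hWne : W.Nonempty) (hWproper : W ≠ Set.univ)
    (v₀ : V)
    (lam : ℝ) (hlam : 1 ≤ lam)
    (ρ : G.edgeSet → Measure ℝ) [∀ e, IsFiniteMeasure (ρ e)]
    (hρne : ∀ e, ρ e ≠ 0)
    (hρsupp : ∀ e, ρ e (Set.Icc lam⁻¹ lam)ᶜ = 0)
    (Z₀ Z₁ : ℝ) (hZ₀ : 0 < Z₀) (hZ₁ : 0 < Z₁)
    (μ₀ μ₁ : Measure (G.edgeSet → ℝ))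
    (hμ₀ : μ₀ = (Measure.pi ρ).withDensity fun c =>
      ENNReal.ofReal (Z₀ * (Real.sqrt (gdet G (extendE G c) {v₀}))⁻¹))
    (hμ₁ : μ₁ = (Measure.pi ρ).withDensity fun c =>
      ENNReal.ofReal (Z₁ * (Real.sqrt (gdet G (extendE G c) W))⁻¹))
    [IsProbabilityMeasure μ₀] [IsProbabilityMeasure μ₁]
    (f : (G.edgeSet → ℝ) → ℝ) (hfmeas : Measurable f)
    (hfbdd : ∃ C : ℝ, ∀ c, |f c| ≤ C)
    (hfmono : ∀ c c' : G.edgeSet → ℝ,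
      (∀ e, 0 < c e) → (∀ e, 0 < c' e) → c ≤ c' → f c ≤ f c') :
    ∫ c, f c ∂μ₀ ≤ ∫ c, f c ∂μ₁ := by
  subst hμ₀ hμ₁
  set B : Set (G.edgeSet → ℝ) := Set.univ.pi fun _ => Set.Icc lam⁻¹ lam with hBdef
  have hpos : ∀ c ∈ B, ∀ e, 0 < c e := fun c hc e =>
    (inv_pos.2 (zero_lt_one.trans_le hlam)).trans_le (hc e (Set.mem_univ e)).1
  have hdens (Z : ℝ) (U : Set V) : Measurable fun c : G.edgeSet → ℝ =>
      ENNReal.ofReal (Z * (Real.sqrt (gdet G (extendE G c) U))⁻¹) :=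
    ((continuous_gdet_extendE G U).measurable.sqrt.inv.const_mul Z).ennreal_ofReal
  have hsup : ∀ c ∈ B, ∀ d ∈ B, c ⊔ d ∈ B := fun c hc d hd e he =>
    ⟨le_sup_of_le_left (hc e he).1, sup_le (hc e he).2 (hd e he).2⟩
  have hinf : ∀ c ∈ B, ∀ d ∈ B, c ⊓ d ∈ B := fun c hc d hd e he =>
    ⟨le_inf (hc e he).1 (hd e he).1, inf_le_of_left_le (hc e he).2⟩
  refine integral_withDensity_le_of_holley ρ (B := B)
    (MeasurableSet.univ_pi fun _ => measurableSet_Icc) ?_ hsup hinf (hdens _ _) (hdens _ _) ?_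
    hfmeas hfbdd fun c hc d hd => hfmono c d (hpos c hc) (hpos d hd)
  · have hae : ∀ e, ∀ᵐ c ∂Measure.pi ρ, c e ∈ Set.Icc lam⁻¹ lam := fun e =>
      Measure.tendsto_eval_ae_ae.eventually (mem_ae_iff.2 (hρsupp e))
    filter_upwards [ae_all_iff.2 hae] with c hc e _
    exact hc e
  · intro c hc d hd
    have hgpos {c : G.edgeSet → ℝ} (hc : c ∈ B) {U : Set V} (hU : U.Nonempty) :
        0 < gdet G (extendE G c) U := gdet_pos hconn (extendE_pos (hpos c hc)) hU
    have h0 : ({v₀} : Set V).Nonempty := Set.singleton_nonempty v₀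
    have h1 := hgpos (hsup c hc d hd) hWne
    have h2 := hgpos (hinf c hc d hd) h0
    have hineq := gdet_inf_mul_gdet_sup_le hconn (hpos c hc) (hpos d hd) hWne v₀
    have hsqrt := inv_anti₀ (Real.sqrt_pos.2 (mul_pos h1 h2)) (Real.sqrt_le_sqrt hineq)
    rw [Real.sqrt_mul (hgpos hc h0).le, Real.sqrt_mul h1.le, mul_inv, mul_inv] at hsqrt
    rw [← ENNReal.ofReal_mul (by positivity), ← ENNReal.ofReal_mul (by positivity)]
    refine ENNReal.ofReal_le_ofReal ?_
    have := mul_le_mul_of_nonneg_left hsqrt (mul_pos hZ₀ hZ₁).le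
    linarith
end

section
/- Monotonicity of the free random conductance measure in the volume: Let G = (V, E) be a finite connected graph and G′ = (V′, E′) a connected subgraph. For each e ∈ E let ρ_e be a nonzero finite Borel measure on (0,∞) supported in [λ^{−1}, λ] for some λ ≥ 1. Let μ^G be the probability measure on (0,∞)^E with density proportional to D_G(κ)^{−1/2} w.r.t. ⊗_{e∈E}ρ_e, and μ^{G′} the probability measure on (0,∞)^{E′} with density proportional to D_{G′}(κ)^{−1/2} w.r.t. ⊗_{e∈E′}ρ_e. Then the marginal of μ^G on the coordinates E′ stochastically dominates μ^{G′}: for every bounded measurable increasing f : (0,∞)^{E′} → ℝ, ∫ f(κ↾E′) dμ^G(κ) ≥ ∫ f dμ^{G′}. -/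
open MeasureTheory
open scoped Classical

/-- Conductances on the coerced subgraph `H.coe` obtained from a configuration
`c : H.edgeSet → ℝ`. -/
noncomputable def subCond {V : Type*} {G : SimpleGraph V} (H : G.Subgraph)
    (c : H.edgeSet → ℝ) : Sym2 H.verts → ℝ :=
  fun e => if h : Sym2.map Subtype.val e ∈ H.edgeSet then c ⟨Sym2.map Subtype.val e, h⟩ else 1

/-- Restriction of a configuration on the edges of `G` to the edges of a subgraph. -/
def restrictConfig {V : Type*} {G : SimpleGraph V} (H : G.Subgraph)
    (c : G.edgeSet → ℝ) : H.edgeSet → ℝ :=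
  fun e => c ⟨e.1, H.edgeSet_subset e.2⟩

section DeterminantRatio

open Matrix

variable {m n : Type*} [Fintype m] [Fintype n]

theorem det_add_vecMulVec_self (A : Matrix n n ℝ) (hA : A.PosDef) (b : n → ℝ) :
    (A + vecMulVec b b).det = A.det * (1 + b ⬝ᵥ (A⁻¹ *ᵥ b)) := by
  rw [vecMulVec_eq Unit, det_add_replicateCol_mul_replicateRow hA.det_pos.ne'.isUnit,
    det_unique (n := Unit)]
  congr 1
  simp [Matrix.mul_apply, dotProduct, mulVec, Finset.sum_mul, Finset.mul_sum]
  rw [Finset.sum_comm]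
  simp only [mul_assoc]

theorem inv_form_le_inv_form (A : Matrix n n ℝ) (B : Matrix m m ℝ) (P : Matrix m n ℝ)
    (hA : A.PosDef) (hB : B.PosDef)
    (hAB : ∀ u, (P *ᵥ u) ⬝ᵥ (B *ᵥ (P *ᵥ u)) ≤ u ⬝ᵥ (A *ᵥ u)) (b : m → ℝ) :
    (Pᵀ *ᵥ b) ⬝ᵥ (A⁻¹ *ᵥ (Pᵀ *ᵥ b)) ≤ b ⬝ᵥ (B⁻¹ *ᵥ b) := by
  set w := A⁻¹ *ᵥ (Pᵀ *ᵥ b) with hw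
  set z := B⁻¹ *ᵥ b with hz
  have hAw : A *ᵥ w = Pᵀ *ᵥ b := by
    rw [hw, mulVec_mulVec, mul_nonsing_inv _ hA.det_pos.ne'.isUnit, one_mulVec]
  have hBz : B *ᵥ z = b := by
    rw [hz, mulVec_mulVec, mul_nonsing_inv _ hB.det_pos.ne'.isUnit, one_mulVec]
  have hBt : Bᵀ = B := by simpa using hB.1.eq
  have h1 := hAB w
  rw [hAw, dotProduct_comm w] at h1
  have h2 := hB.posSemidef.dotProduct_mulVec_nonneg (z - P *ᵥ w)
  have h3 : (Pᵀ *ᵥ b) ⬝ᵥ w = b ⬝ᵥ (P *ᵥ w) := by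
    rw [mulVec_transpose, ← dotProduct_mulVec]
  have h4 : z ⬝ᵥ (B *ᵥ (P *ᵥ w)) = b ⬝ᵥ (P *ᵥ w) := by
    rw [dotProduct_mulVec, ← mulVec_transpose, hBt, hBz]
  simp only [star_trivial, mulVec_sub, sub_dotProduct, dotProduct_sub, hBz, h4] at h2
  rw [dotProduct_comm z b, dotProduct_comm (P *ᵥ w) b] at h2
  linarith

theorem posSemidef_vecMulVec_self (b : n → ℝ) : (vecMulVec b b).PosSemidef := by
  simpa using posSemidef_vecMulVec_self_star b

/-- The relative increase of the determinant under a positive semidefinite perturbation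
decreases with the matrix. -/
theorem det_add_mul_det_le (A : Matrix n n ℝ) (B D : Matrix m m ℝ) (P : Matrix m n ℝ)
    (hA : A.PosDef) (hB : B.PosDef) (hD : D.PosSemidef)
    (hAB : ∀ u, (P *ᵥ u) ⬝ᵥ (B *ᵥ (P *ᵥ u)) ≤ u ⬝ᵥ (A *ᵥ u)) :
    B.det * (A + Pᵀ * D * P).det ≤ (B + D).det * A.det := by
  obtain ⟨C, rfl⟩ : ∃ C : Matrix m m ℝ, D = Cᵀ * C := by
    open scoped MatrixOrder ComplexOrder in
    obtain ⟨C, hC⟩ := CStarAlgebra.nonneg_iff_eq_star_mul_self.mp hD.nonneg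
    exact ⟨C, by simpa [star_eq_conjTranspose] using hC⟩
  have hrank (b : m → ℝ) : Pᵀ * vecMulVec b b * P = vecMulVec (Pᵀ *ᵥ b) (Pᵀ *ᵥ b) := by
    rw [mul_vecMulVec, vecMulVec_mul, mulVec_transpose P b]
  have hsum : Cᵀ * C = ∑ i, vecMulVec (C i) (C i) := by
    ext j k
    simp [Matrix.mul_apply, Matrix.sum_apply, vecMulVec_apply]
  have key (s : Finset m) :
      (A + Pᵀ * (∑ i ∈ s, vecMulVec (C i) (C i)) * P).PosDef ∧
      (B + ∑ i ∈ s, vecMulVec (C i) (C i)).PosDef ∧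
      B.det * (A + Pᵀ * (∑ i ∈ s, vecMulVec (C i) (C i)) * P).det ≤
        (B + ∑ i ∈ s, vecMulVec (C i) (C i)).det * A.det := by
    induction s using Finset.induction_on with
    | empty => simp [hA, hB]
    | insert i s hi ih =>
      obtain ⟨h1, h2, h3⟩ := ih
      rw [Finset.sum_insert hi, add_comm (vecMulVec _ _), Matrix.mul_add, Matrix.add_mul,
        ← add_assoc, ← add_assoc, hrank, det_add_vecMulVec_self _ h1, det_add_vecMulVec_self _ h2]
      refine ⟨h1.add_posSemidef (posSemidef_vecMulVec_self _),
        h2.add_posSemidef (posSemidef_vecMulVec_self _), ?_⟩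
      have h4 := inv_form_le_inv_form _ _ P h1 h2 (fun u => by
        have h5 := hAB u
        have h6 (E : Matrix m m ℝ) :
            u ⬝ᵥ ((Pᵀ * E * P) *ᵥ u) = (P *ᵥ u) ⬝ᵥ (E *ᵥ (P *ᵥ u)) := by
          rw [← mulVec_mulVec, ← mulVec_mulVec, dotProduct_mulVec, ← mulVec_transpose,
            transpose_transpose]
        rw [add_mulVec, add_mulVec, dotProduct_add, dotProduct_add, h6]
        linarith) (C i)
      have h7 := h1.inv.posSemidef.dotProduct_mulVec_nonneg (Pᵀ *ᵥ C i)
      rw [star_trivial] at h7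
      calc _ = (B.det * (A + Pᵀ * (∑ i ∈ s, vecMulVec (C i) (C i)) * P).det) * _ := by
            rw [mul_assoc]
        _ ≤ ((B + ∑ i ∈ s, vecMulVec (C i) (C i)).det * A.det) *
            (1 + C i ⬝ᵥ ((B + ∑ i ∈ s, vecMulVec (C i) (C i))⁻¹ *ᵥ C i)) :=
          mul_le_mul h3 (by linarith) (by linarith) (mul_nonneg h2.det_pos.le hA.det_pos.le)
        _ = _ := by ring
  rw [hsum]
  exact (key Finset.univ).2.2

end DeterminantRatio

section FourFunctions

open scoped ENNReal

theorem ENNReal.add_le_add_of_mul_le_mul {a b c d : ℝ≥0∞} (hac : a ≤ c) (hbc : b ≤ c)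
    (h : a * b ≤ c * d) : a + b ≤ c + d := by
  rcases eq_or_ne c ∞ with rfl | hc
  · simp
  rcases eq_or_ne d ∞ with rfl | hd
  · simp
  lift c to NNReal using hc
  lift d to NNReal using hd
  lift a to NNReal using (hac.trans_lt ENNReal.coe_lt_top).ne
  lift b to NNReal using (hbc.trans_lt ENNReal.coe_lt_top).ne
  norm_cast at *
  rw [← NNReal.coe_le_coe] at *
  push_cast at *
  rcases (NNReal.coe_nonneg c).eq_or_lt with h0 | h0
  · nlinarith [NNReal.coe_nonneg a, NNReal.coe_nonneg b, NNReal.coe_nonneg d]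
  · refine le_of_mul_le_mul_left ?_ h0
    nlinarith [mul_nonneg (sub_nonneg.2 hac) (sub_nonneg.2 hbc)]

theorem lintegral_mul_lintegral_le_of_sup_inf (μ : Measure ℝ) [SFinite μ]
    {f₁ f₂ f₃ f₄ : ℝ → ℝ≥0∞} (hf₁ : Measurable f₁) (hf₂ : Measurable f₂) (hf₃ : Measurable f₃)
    (hf₄ : Measurable f₄) (h : ∀ x y, f₁ x * f₂ y ≤ f₃ (x ⊔ y) * f₄ (x ⊓ y)) :
    (∫⁻ x, f₁ x ∂μ) * ∫⁻ x, f₂ x ∂μ ≤ (∫⁻ x, f₃ x ∂μ) * ∫⁻ x, f₄ x ∂μ := by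
  have hprod {f g : ℝ → ℝ≥0∞} (hf : Measurable f) (hg : Measurable g) :
      2 * ((∫⁻ x, f x ∂μ) * ∫⁻ x, g x ∂μ) =
        ∫⁻ z, f z.1 * g z.2 + f z.2 * g z.1 ∂(μ.prod μ) := by
    rw [lintegral_add_left (by fun_prop), lintegral_prod_mul hf.aemeasurable hg.aemeasurable,
      two_mul]
    congr 1
    simp_rw [mul_comm (f _)]
    rw [lintegral_prod_mul hg.aemeasurable hf.aemeasurable, mul_comm]
  rw [← ENNReal.mul_le_mul_iff_right (a := 2) (by simp) (by simp), hprod hf₁ hf₂, hprod hf₃ hf₄]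
  refine lintegral_mono fun ⟨x, y⟩ => ?_
  have main {x y : ℝ} (hxy : x ≤ y) :
      f₁ x * f₂ y + f₁ y * f₂ x ≤ f₃ y * f₄ x + f₃ x * f₄ y := by
    have hxy' := h x y
    have hyx := h y x
    have hxx := h x x
    have hyy := h y y
    simp only [sup_of_le_right hxy, inf_of_le_left hxy, sup_of_le_left hxy, inf_of_le_right hxy,
      sup_idem, inf_idem] at hxy' hyx hxx hyy
    refine ENNReal.add_le_add_of_mul_le_mul hxy' hyx ?_
    calc f₁ x * f₂ y * (f₁ y * f₂ x) = (f₁ x * f₂ x) * (f₁ y * f₂ y) := by ring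
      _ ≤ (f₃ x * f₄ x) * (f₃ y * f₄ y) := mul_le_mul' hxx hyy
      _ = f₃ y * f₄ x * (f₃ x * f₄ y) := by ring
  rcases le_total x y with hxy | hxy
  · simpa only [add_comm (f₃ x * f₄ y)] using main hxy
  · simpa only [add_comm (f₁ x * f₂ y)] using main hxy

/-- The continuous four functions theorem for product measures. -/
theorem lintegral_pi_mul_lintegral_pi_le_of_sup_inf {ι : Type*} [Fintype ι] (μ : ι → Measure ℝ)
    [∀ i, SigmaFinite (μ i)] {f₁ f₂ f₃ f₄ : (ι → ℝ) → ℝ≥0∞} (hf₁ : Measurable f₁)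
    (hf₂ : Measurable f₂) (hf₃ : Measurable f₃) (hf₄ : Measurable f₄)
    (h : ∀ x y, f₁ x * f₂ y ≤ f₃ (x ⊔ y) * f₄ (x ⊓ y)) :
    (∫⁻ x, f₁ x ∂Measure.pi μ) * ∫⁻ x, f₂ x ∂Measure.pi μ ≤
      (∫⁻ x, f₃ x ∂Measure.pi μ) * ∫⁻ x, f₄ x ∂Measure.pi μ := by
  have key (s : Finset ι) (x y : ι → ℝ) :
      (lmarginal μ s f₁) x * (lmarginal μ s f₂) y ≤
        (lmarginal μ s f₃) (x ⊔ y) * (lmarginal μ s f₄) (x ⊓ y) := by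
    induction s using Finset.induction_on generalizing x y with
    | empty => simpa using h x y
    | insert i s hi ih =>
      have hmeas {f : (ι → ℝ) → ℝ≥0∞} (hf : Measurable f) (x : ι → ℝ) :
          Measurable fun a => (lmarginal μ s f) (Function.update x i a) :=
        (hf.lmarginal μ).comp (measurable_update x)
      simp only [lmarginal_insert _ hf₁ hi, lmarginal_insert _ hf₂ hi,
        lmarginal_insert _ hf₃ hi, lmarginal_insert _ hf₄ hi]
      refine lintegral_mul_lintegral_le_of_sup_inf (μ i) (hmeas hf₁ _) (hmeas hf₂ _)
        (hmeas hf₃ _) (hmeas hf₄ _) fun a b => ?_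
      convert ih (Function.update x i a) (Function.update y i b) using 3
      · ext j
        by_cases hj : j = i
        · subst hj; simp
        · simp [hj]
      · ext j
        by_cases hj : j = i
        · subst hj; simp
        · simp [hj]
  simpa using key Finset.univ 0 0

end FourFunctions

section PinnedLaplacian

open Matrix

variable {α : Type*} [Fintype α]

/-- The conductance between two vertices, zero when they are not adjacent. -/
noncomputable def condWeight (G : SimpleGraph α) (κ : Sym2 α → ℝ) (x y : α) : ℝ :=
  if G.Adj x y then κ s(x, y) else 0

theorem condWeight_comm {α : Type*} (G : SimpleGraph α) (κ : Sym2 α → ℝ) (x y : α) :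
    condWeight G κ x y = condWeight G κ y x := by
  simp only [condWeight, G.adj_comm x y, Sym2.eq_swap (a := x)]

theorem glap_apply (G : SimpleGraph α) (κ : Sym2 α → ℝ) (x y : α) :
    glap G κ x y = (if x = y then ∑ z, condWeight G κ x z else 0) - condWeight G κ x y := by
  by_cases h : x = y
  · subst h
    simp [glap, condWeight]
  · by_cases h' : G.Adj x y <;> simp [glap, condWeight, h, h']

theorem glap_form (G : SimpleGraph α) (κ : Sym2 α → ℝ) (u v : α → ℝ) :
    2 * (u ⬝ᵥ (glap G κ *ᵥ v)) =
      ∑ x, ∑ y, condWeight G κ x y * ((u x - u y) * (v x - v y)) := by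
  have h1 : u ⬝ᵥ (glap G κ *ᵥ v) = ∑ x, ∑ y, condWeight G κ x y * (u x * (v x - v y)) := by
    refine Finset.sum_congr rfl fun x _ => ?_
    simp only [mulVec, dotProduct, glap_apply, sub_mul, ite_mul, zero_mul,
      Finset.sum_sub_distrib, Finset.sum_ite_eq, Finset.mem_univ, if_true, mul_sub,
      Finset.sum_mul, Finset.mul_sum]
    refine congrArg₂ (· - ·) ?_ ?_ <;> exact Finset.sum_congr rfl fun y _ => by ring
  have h2 : u ⬝ᵥ (glap G κ *ᵥ v) = ∑ x, ∑ y, condWeight G κ x y * (u y * (v y - v x)) := by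
    rw [h1, Finset.sum_comm]
    exact Finset.sum_congr rfl fun x _ => Finset.sum_congr rfl fun y _ => by
      rw [condWeight_comm]
  rw [two_mul]
  nth_rewrite 1 [h1]
  rw [h2, ← Finset.sum_add_distrib]
  refine Finset.sum_congr rfl fun x _ => ?_
  rw [← Finset.sum_add_distrib]
  exact Finset.sum_congr rfl fun y _ => by ring

/-- The vertices other than `w`. -/
@[ext]
structure OffVertex {α : Type*} (w : α) where
  /-- The underlying vertex. -/
  val : α
  ne : val ≠ w

/-- The vertices other than `w` as a subtype. -/
def OffVertex.equivSubtype {α : Type*} (w : α) : {x : α // x ∉ ({w} : Set α)} ≃ OffVertex w where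
  toFun x := ⟨x.1, x.2⟩
  invFun x := ⟨x.1, x.2⟩
  left_inv _ := rfl
  right_inv _ := rfl

noncomputable instance {α : Type*} [Fintype α] (w : α) : Fintype (OffVertex w) :=
  Fintype.ofEquiv _ (OffVertex.equivSubtype w)

/-- The Laplacian with the row and column of the vertex `w` deleted. -/
noncomputable def pinnedLap (G : SimpleGraph α) (κ : Sym2 α → ℝ) (w : α) :
    Matrix (OffVertex w) (OffVertex w) ℝ :=
  (glap G κ).submatrix OffVertex.val OffVertex.val

theorem gdet_singleton (G : SimpleGraph α) (κ : Sym2 α → ℝ) (w : α) :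
    gdet G κ {w} = (pinnedLap G κ w).det := by
  rw [← det_submatrix_equiv_self (OffVertex.equivSubtype w)]
  unfold gdet pinnedLap
  congr!

/-- Extension of a function off `w` by zero at `w`. -/
noncomputable def extendZero {w : α} (u : OffVertex w → ℝ) (x : α) : ℝ :=
  if h : x ≠ w then u ⟨x, h⟩ else 0

theorem extendZero_coe {α : Type*} {w : α} (u : OffVertex w → ℝ)
    (x : OffVertex w) : extendZero u x.1 = u x :=
  dif_pos x.2

theorem extendZero_self {α : Type*} {w : α} (u : OffVertex w → ℝ) : extendZero u w = 0 := by
  simp [extendZero]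

theorem sum_mul_extendZero {w : α} (g : α → ℝ) (u : OffVertex w → ℝ) :
    ∑ x, g x * extendZero u x = ∑ x : OffVertex w, g x.1 * u x := by
  rw [← Fintype.sum_subtype_add_sum_subtype (fun x => x ∉ ({w} : Set α))]
  have h0 : ∑ x : {x // ¬ x ∉ ({w} : Set α)}, g x * extendZero u x = 0 :=
    Finset.sum_eq_zero fun x _ => by
      rw [extendZero, dif_neg fun h : x.1 ≠ w => x.2 h, mul_zero]
  rw [h0, add_zero, ← (OffVertex.equivSubtype w).sum_comp]
  exact Finset.sum_congr rfl fun x _ => by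
    rw [← extendZero_coe u]
    rfl

theorem pinnedLap_form (G : SimpleGraph α) (κ : Sym2 α → ℝ) (w : α)
    (u v : OffVertex w → ℝ) :
    2 * (u ⬝ᵥ (pinnedLap G κ w *ᵥ v)) =
      ∑ x, ∑ y, condWeight G κ x y *
        ((extendZero u x - extendZero u y) * (extendZero v x - extendZero v y)) := by
  rw [← glap_form]
  congr 1
  rw [dotProduct_comm, dotProduct_comm (extendZero u)]
  simp only [dotProduct, sum_mul_extendZero, mulVec, pinnedLap, submatrix_apply]

theorem pinnedLap_isHermitian (G : SimpleGraph α) (κ : Sym2 α → ℝ) (w : α) :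
    (pinnedLap G κ w).IsHermitian := by
  refine IsHermitian.ext fun i j => ?_
  simp only [pinnedLap, submatrix_apply, glap_apply, star_trivial, condWeight_comm G κ i.1 j.1]
  by_cases h : i = j
  · subst h; rfl
  · rw [if_neg (fun h' => h (OffVertex.ext h').symm), if_neg (fun h' => h (OffVertex.ext h'))]

theorem pinnedLap_posDef (G : SimpleGraph α) (hG : G.Connected) (κ : Sym2 α → ℝ)
    (hκ : ∀ x y, G.Adj x y → 0 < κ s(x, y)) (w : α) : (pinnedLap G κ w).PosDef := by
  refine .of_dotProduct_mulVec_pos (pinnedLap_isHermitian G κ w) fun u hu => ?_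
  rw [star_trivial]
  have hnn (x y : α) : 0 ≤ condWeight G κ x y *
      ((extendZero u x - extendZero u y) * (extendZero u x - extendZero u y)) := by
    refine mul_nonneg ?_ (mul_self_nonneg _)
    unfold condWeight
    split_ifs with h
    exacts [(hκ x y h).le, le_rfl]
  have hform := pinnedLap_form G κ w u u
  by_contra hle
  have h0 : ∑ x, ∑ y, condWeight G κ x y *
      ((extendZero u x - extendZero u y) * (extendZero u x - extendZero u y)) = 0 :=
    le_antisymm (by linarith) (Finset.sum_nonneg fun x _ => Finset.sum_nonneg fun y _ => hnn x y)
  have hadj (x y : α) (h : G.Adj x y) : extendZero u x = extendZero u y := by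
    have h1 := (Finset.sum_eq_zero_iff_of_nonneg
      fun x _ => Finset.sum_nonneg fun y _ => hnn x y).1 h0 x (Finset.mem_univ _)
    have h2 := (Finset.sum_eq_zero_iff_of_nonneg fun y _ => hnn x y).1 h1 y (Finset.mem_univ _)
    rw [condWeight, if_pos h] at h2
    have h3 := (mul_eq_zero.1 h2).resolve_left (hκ x y h).ne'
    exact sub_eq_zero.1 (mul_self_eq_zero.1 h3)
  have hconst (x y : α) (p : G.Walk x y) : extendZero u x = extendZero u y := by
    induction p with
    | nil => rfl
    | cons h _ ih => exact (hadj _ _ h).trans ih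
  refine hu (funext fun x => ?_)
  obtain ⟨p⟩ := hG.preconnected x.1 w
  rw [← extendZero_coe u x, hconst _ _ p, extendZero_self, Pi.zero_apply]

end PinnedLaplacian

section SubgraphDeterminant

open Matrix

variable {V : Type*} [Fintype V] {G : SimpleGraph V} (H : G.Subgraph)

/-- Differences of a function on the vertices off `w` relative to the vertex `w'` of the
subgraph. -/
noncomputable def repinMatrix (w : V) (w' : H.verts) :
    Matrix (OffVertex w') (OffVertex w) ℝ :=
  Matrix.of fun x y => (if x.1.1 = y.1 then 1 else 0) - (if w'.1 = y.1 then 1 else 0)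

theorem extendZero_repinMatrix_mulVec (w : V) (w' : H.verts)
    (u : OffVertex w → ℝ) (x : H.verts) :
    extendZero (repinMatrix H w w' *ᵥ u) x = extendZero u x.1 - extendZero u w'.1 := by
  by_cases hx : x = w'
  · subst hx
    rw [extendZero_self, sub_self]
  · rw [extendZero, dif_pos hx]
    have h (z : V) : ∑ y : OffVertex w, (if z = y.1 then 1 else 0) * u y =
        extendZero u z := by
      rw [← sum_mul_extendZero (fun y => if z = y then 1 else 0) u]
      simp
    simp only [mulVec, dotProduct, repinMatrix, of_apply, sub_mul, Finset.sum_sub_distrib, h]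

/-- The conductance of a subgraph configuration between two vertices, zero when they are not
adjacent in the subgraph. -/
noncomputable def subWeight (c : H.edgeSet → ℝ) (x y : V) : ℝ :=
  if h : s(x, y) ∈ H.edgeSet then c ⟨s(x, y), h⟩ else 0

theorem condWeight_subCond {V : Type*} {G : SimpleGraph V} (H : G.Subgraph) [Fintype H.verts]
    (c : H.edgeSet → ℝ) (x y : H.verts) :
    condWeight H.coe (subCond H c) x y = subWeight H c x y := by
  have hiff : H.coe.Adj x y ↔ s(x.1, y.1) ∈ H.edgeSet := Iff.rfl
  by_cases h : s(x.1, y.1) ∈ H.edgeSet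
  · rw [condWeight, if_pos (hiff.2 h), subCond, dif_pos (by exact h), subWeight, dif_pos h]
    rfl
  · rw [condWeight, if_neg (hiff.not.2 h), subWeight, dif_neg h]

theorem pinnedLap_subCond_form (c : H.edgeSet → ℝ) (w : V) (w' : H.verts)
    (u v : OffVertex w → ℝ) :
    2 * ((repinMatrix H w w' *ᵥ u) ⬝ᵥ
        (pinnedLap H.coe (subCond H c) w' *ᵥ (repinMatrix H w w' *ᵥ v))) =
      ∑ x, ∑ y, subWeight H c x y *
        ((extendZero u x - extendZero u y) * (extendZero v x - extendZero v y)) := by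
  have hsum (g : V → ℝ) (hg : ∀ x, x ∉ H.verts → g x = 0) : ∑ x, g x = ∑ x : H.verts, g x := by
    rw [← Fintype.sum_subtype_add_sum_subtype (fun x => x ∈ H.verts), add_eq_left]
    exact Finset.sum_eq_zero fun x _ => hg _ x.2
  have hsub (x y : V) (h : x ∉ H.verts ∨ y ∉ H.verts) : subWeight H c x y = 0 := by
    refine dif_neg fun he => ?_
    rw [SimpleGraph.Subgraph.mem_edgeSet] at he
    exact h.elim (fun h => h he.fst_mem) (fun h => h he.snd_mem)
  rw [pinnedLap_form, hsum _ fun x hx => Finset.sum_eq_zero fun y _ => by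
    rw [hsub x y (.inl hx), zero_mul]]
  refine Finset.sum_congr rfl fun x _ => ?_
  rw [hsum _ fun y hy => by rw [hsub x y (.inr hy), zero_mul]]
  refine Finset.sum_congr rfl fun y _ => ?_
  simp only [extendZero_repinMatrix_mulVec, condWeight_subCond, sub_sub_sub_cancel_right]

/-- Increasing the conductances of the subgraph by the same amount increases the determinant of
the subgraph, at smaller conductances, by a larger factor than that of the whole graph. -/
theorem gdet_mul_gdet_le (hG : G.Connected) (hH : H.Connected) (w : V) (w' : H.verts)
    (a a' : H.edgeSet → ℝ) (c c' : G.edgeSet → ℝ) (ha : ∀ e, 0 < a e) (hc : ∀ e, 0 < c e)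
    (hac : a ≤ restrictConfig H c) (haa' : a ≤ a')
    (hmem : ∀ e : H.edgeSet, restrictConfig H c' e = restrictConfig H c e + (a' e - a e))
    (hnotMem : ∀ e : G.edgeSet, e.1 ∉ H.edgeSet → c' e = c e) :
    gdet H.coe (subCond H a) {w'} * gdet G (extendE G c') {w} ≤
      gdet H.coe (subCond H a') {w'} * gdet G (extendE G c) {w} := by
  simp only [gdet_singleton]
  have hcw (c : G.edgeSet → ℝ) (x y : V) (h : G.Adj x y) :
      condWeight G (extendE G c) x y = c ⟨s(x, y), h⟩ := by
    rw [condWeight, if_pos h, extendE, dif_pos (show s(x, y) ∈ G.edgeSet from h)]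
  have hcw0 (c : G.edgeSet → ℝ) (x y : V) (h : ¬ G.Adj x y) :
      condWeight G (extendE G c) x y = 0 := if_neg h
  have hsw (b : H.edgeSet → ℝ) (x y : V) (h : s(x, y) ∈ H.edgeSet) :
      subWeight H b x y = b ⟨s(x, y), h⟩ := dif_pos h
  have hsw0 (b : H.edgeSet → ℝ) (x y : V) (h : s(x, y) ∉ H.edgeSet) :
      subWeight H b x y = 0 := dif_neg h
  have hweight (x y : V) : condWeight G (extendE G c') x y =
      condWeight G (extendE G c) x y + (subWeight H a' x y - subWeight H a x y) := by
    by_cases h : s(x, y) ∈ H.edgeSet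
    · have hx : G.Adj x y := H.edgeSet_subset h
      rw [hcw _ _ _ hx, hcw _ _ _ hx, hsw _ _ _ h, hsw _ _ _ h]
      exact hmem ⟨_, h⟩
    · rw [hsw0 _ _ _ h, hsw0 _ _ _ h, sub_self, add_zero]
      by_cases hx : G.Adj x y
      · rw [hcw _ _ _ hx, hcw _ _ _ hx, hnotMem _ h]
      · rw [hcw0 _ _ _ hx, hcw0 _ _ _ hx]
  have hle (x y : V) : subWeight H a x y ≤ condWeight G (extendE G c) x y := by
    by_cases h : s(x, y) ∈ H.edgeSet
    · rw [hcw _ _ _ (H.edgeSet_subset h), hsw _ _ _ h]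
      exact hac ⟨_, h⟩
    · rw [hsw0 _ _ _ h]
      by_cases hx : G.Adj x y
      · rw [hcw _ _ _ hx]
        exact (hc _).le
      · rw [hcw0 _ _ _ hx]
  set A := pinnedLap G (extendE G c) w with hA
  set B := pinnedLap H.coe (subCond H a) w' with hB
  set B' := pinnedLap H.coe (subCond H a') w' with hB'
  set P := repinMatrix H w w' with hP
  have hA' : pinnedLap G (extendE G c') w = A + Pᵀ * (B' - B) * P := by
    have hform (u v : OffVertex w → ℝ) :
        u ⬝ᵥ (pinnedLap G (extendE G c') w *ᵥ v) = u ⬝ᵥ ((A + Pᵀ * (B' - B) * P) *ᵥ v) := by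
      have e1 := pinnedLap_form G (extendE G c') w u v
      simp only [hweight, add_mul, sub_mul (subWeight _ _ _ _), Finset.sum_add_distrib,
        Finset.sum_sub_distrib] at e1
      have e2 := pinnedLap_form G (extendE G c) w u v
      have e3 := pinnedLap_subCond_form H a w w' u v
      have e4 := pinnedLap_subCond_form H a' w w' u v
      rw [add_mulVec, dotProduct_add, ← mulVec_mulVec, ← mulVec_mulVec,
        dotProduct_mulVec u Pᵀ, ← mulVec_transpose, transpose_transpose, sub_mulVec,
        dotProduct_sub]
      linarith
    ext i j
    simpa using hform (Pi.single i 1) (Pi.single j 1)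
  have hApd : A.PosDef := pinnedLap_posDef G hG _ (fun x y h => by
    rw [extendE, dif_pos (show s(x, y) ∈ G.edgeSet from h)]
    exact hc _) w
  have hBpd : B.PosDef := pinnedLap_posDef H.coe hH.coe _ (fun x y h => by
    rw [subCond, dif_pos (show Sym2.map Subtype.val s(x, y) ∈ H.edgeSet from h)]
    exact ha _) w'
  have hD : (B' - B).PosSemidef := by
    refine .of_dotProduct_mulVec_nonneg
      ((pinnedLap_isHermitian _ _ _).sub (pinnedLap_isHermitian _ _ _)) fun u => ?_
    rw [star_trivial, sub_mulVec, dotProduct_sub]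
    have e1 := pinnedLap_form H.coe (subCond H a) w' u u
    have e2 := pinnedLap_form H.coe (subCond H a') w' u u
    have e3 : ∑ x, ∑ y, condWeight H.coe (subCond H a) x y *
          ((extendZero u x - extendZero u y) * (extendZero u x - extendZero u y)) ≤
        ∑ x, ∑ y, condWeight H.coe (subCond H a') x y *
          ((extendZero u x - extendZero u y) * (extendZero u x - extendZero u y)) := by
      refine Finset.sum_le_sum fun x _ => Finset.sum_le_sum fun y _ =>
        mul_le_mul_of_nonneg_right ?_ (mul_self_nonneg _)
      rw [condWeight_subCond, condWeight_subCond]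
      by_cases h : s(x.1, y.1) ∈ H.edgeSet
      · rw [hsw _ _ _ h, hsw _ _ _ h]
        exact haa' _
      · rw [hsw0 _ _ _ h, hsw0 _ _ _ h]
    linarith
  have := det_add_mul_det_le A B (B' - B) P hApd hBpd hD fun u => by
    have e1 := pinnedLap_form G (extendE G c) w u u
    have e2 := pinnedLap_subCond_form H a w w' u u
    have e3 : ∑ x, ∑ y, subWeight H a x y *
          ((extendZero u x - extendZero u y) * (extendZero u x - extendZero u y)) ≤
        ∑ x, ∑ y, condWeight G (extendE G c) x y *
          ((extendZero u x - extendZero u y) * (extendZero u x - extendZero u y)) :=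
      Finset.sum_le_sum fun x _ => Finset.sum_le_sum fun y _ =>
        mul_le_mul_of_nonneg_right (hle x y) (mul_self_nonneg _)
    linarith
  rwa [add_sub_cancel, ← hA'] at this

theorem gdet_pos_s11 {α : Type*} [Fintype α] (G : SimpleGraph α) (hG : G.Connected) (κ : Sym2 α → ℝ)
    (hκ : ∀ x y, G.Adj x y → 0 < κ s(x, y)) (w : α) : 0 < gdet G κ {w} := by
  rw [gdet_singleton]
  exact (pinnedLap_posDef G hG κ hκ w).det_pos

theorem continuous_gdet {α β : Type*} [Fintype α] [TopologicalSpace β] (G : SimpleGraph α)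
    (κ : β → Sym2 α → ℝ) (hκ : Continuous κ) (W : Set α) :
    Continuous fun b => gdet G (κ b) W := by
  unfold gdet
  refine Continuous.matrix_det (continuous_matrix fun i j => ?_)
  simp only [submatrix_apply, glap, of_apply]
  split_ifs
  · refine continuous_finsetSum _ fun z _ => ?_
    split_ifs <;> fun_prop
  · fun_prop
  · fun_prop

end SubgraphDeterminant

section JoinConfig

variable {V : Type*} {G : SimpleGraph V} (H : G.Subgraph)

/-- The configuration on the edges of `G` with given values on and off the edges of `H`. -/
noncomputable def joinConfig (x : H.edgeSet → ℝ) (y : {e : G.edgeSet // e.1 ∉ H.edgeSet} → ℝ) :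
    G.edgeSet → ℝ :=
  fun e => if h : e.1 ∈ H.edgeSet then x ⟨e.1, h⟩ else y ⟨e, h⟩

theorem joinConfig_of_notMem (x : H.edgeSet → ℝ) (y : {e : G.edgeSet // e.1 ∉ H.edgeSet} → ℝ)
    (e : G.edgeSet) (h : e.1 ∉ H.edgeSet) : joinConfig H x y e = y ⟨e, h⟩ :=
  dif_neg h

theorem restrictConfig_joinConfig (x : H.edgeSet → ℝ)
    (y : {e : G.edgeSet // e.1 ∉ H.edgeSet} → ℝ) : restrictConfig H (joinConfig H x y) = x :=
  funext fun e => dif_pos e.2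

theorem measurable_joinConfig :
    Measurable fun z : (H.edgeSet → ℝ) × ({e : G.edgeSet // e.1 ∉ H.edgeSet} → ℝ) =>
      joinConfig H z.1 z.2 := by
  refine measurable_pi_lambda _ fun e => ?_
  by_cases h : e.1 ∈ H.edgeSet
  · simp only [joinConfig, h, dif_pos]
    fun_prop
  · simp only [joinConfig, h, dif_neg, not_false_eq_true]
    fun_prop

theorem map_joinConfig_prod [Fintype G.edgeSet] [Fintype H.edgeSet]
    [Fintype {e : G.edgeSet // e.1 ∉ H.edgeSet}] (ρ : G.edgeSet → Measure ℝ)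
    [∀ e, IsFiniteMeasure (ρ e)] :
    ((Measure.pi fun e : H.edgeSet => ρ ⟨e.1, H.edgeSet_subset e.2⟩).prod
      (Measure.pi fun e : {e : G.edgeSet // e.1 ∉ H.edgeSet} => ρ e.1)).map
        (fun z => joinConfig H z.1 z.2) = Measure.pi ρ := by
  refine (Measure.pi_eq fun s hs => ?_).symm
  have hpre : (fun z : (H.edgeSet → ℝ) × ({e : G.edgeSet // e.1 ∉ H.edgeSet} → ℝ) =>
      joinConfig H z.1 z.2) ⁻¹' Set.univ.pi s =
      (Set.univ.pi fun e : H.edgeSet => s ⟨e.1, H.edgeSet_subset e.2⟩) ×ˢ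
        (Set.univ.pi fun e : {e : G.edgeSet // e.1 ∉ H.edgeSet} => s e.1) := by
    ext ⟨x, y⟩
    simp only [Set.mem_preimage, Set.mem_univ_pi, Set.mem_prod]
    constructor
    · intro h
      refine ⟨fun e => ?_, fun e => ?_⟩
      · rw [← restrictConfig_joinConfig H x y]
        exact h ⟨e.1, H.edgeSet_subset e.2⟩
      · rw [← joinConfig_of_notMem H x y e.1 e.2]
        exact h e.1
    · rintro ⟨h1, h2⟩ e
      by_cases h : e.1 ∈ H.edgeSet
      · rw [joinConfig, dif_pos h]
        exact h1 ⟨e.1, h⟩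
      · rw [joinConfig, dif_neg h]
        exact h2 ⟨e, h⟩
  let edgeEquiv : {e : G.edgeSet // e.1 ∈ H.edgeSet} ≃ H.edgeSet :=
    { toFun := fun e => ⟨e.1.1, e.2⟩
      invFun := fun e => ⟨⟨e.1, H.edgeSet_subset e.2⟩, e.2⟩
      left_inv := fun _ => rfl
      right_inv := fun _ => rfl }
  rw [Measure.map_apply (measurable_joinConfig H) (MeasurableSet.univ_pi hs), hpre,
    Measure.prod_prod, Measure.pi_pi, Measure.pi_pi,
    ← Fintype.prod_subtype_mul_prod_subtype (fun e : G.edgeSet => e.1 ∈ H.edgeSet),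
    ← edgeEquiv.prod_comp]
  refine congrArg₂ (· * ·) (Finset.prod_congr (by ext; simp) fun e _ => rfl)
    (Finset.prod_congr (by ext; simp) fun e _ => rfl)

end JoinConfig

theorem ae_pi_forall_pos {ι : Type*} [Fintype ι] (ρ : ι → Measure ℝ) [∀ i, SigmaFinite (ρ i)]
    (h : ∀ i, ∀ᵐ t ∂ρ i, 0 < t) : ∀ᵐ x ∂Measure.pi ρ, ∀ i, 0 < x i :=
  Filter.eventually_all.2 fun i => Measure.tendsto_eval_ae_ae.eventually (h i)

/-- **Monotonicity of the free random conductance measure in the volume**: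
the marginal on the edges `E′` of a connected subgraph `G′` of the free measure `μ^G`
stochastically dominates `μ^{G′}`. -/
theorem free_measure_marginal_dominates
    {V : Type*} [Fintype V] (G : SimpleGraph V) (hconn : G.Connected)
    (H : G.Subgraph) (hHconn : H.Connected)
    (v₀ : V) (v₀' : H.verts)
    (lam : ℝ) (hlam : 1 ≤ lam)
    (ρ : G.edgeSet → Measure ℝ) [∀ e, IsFiniteMeasure (ρ e)]
    (hρne : ∀ e, ρ e ≠ 0)
    (hρsupp : ∀ e, ρ e (Set.Icc lam⁻¹ lam)ᶜ = 0)
    (Z ZH : ℝ) (hZ : 0 < Z) (hZH : 0 < ZH)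
    (μG : Measure (G.edgeSet → ℝ)) (μH : Measure (H.edgeSet → ℝ))
    (hμG : μG = (Measure.pi ρ).withDensity fun c =>
      ENNReal.ofReal (Z * (Real.sqrt (gdet G (extendE G c) {v₀}))⁻¹))
    (hμH : μH = (Measure.pi fun e : H.edgeSet => ρ ⟨e.1, H.edgeSet_subset e.2⟩).withDensity
      fun c => ENNReal.ofReal (ZH * (Real.sqrt (gdet H.coe (subCond H c) {v₀'}))⁻¹))
    [IsProbabilityMeasure μG] [IsProbabilityMeasure μH]
    (f : (H.edgeSet → ℝ) → ℝ) (hfmeas : Measurable f)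
    (hfbdd : ∃ C : ℝ, ∀ c, |f c| ≤ C)
    (hfmono : ∀ c c' : H.edgeSet → ℝ,
      (∀ e, 0 < c e) → (∀ e, 0 < c' e) → c ≤ c' → f c ≤ f c') :
    ∫ c, f c ∂μH ≤ ∫ c, f (restrictConfig H c) ∂μG := by
  obtain ⟨C, hC⟩ := hfbdd
  have hlam0 : 0 < lam⁻¹ := by positivity
  have hρpos (e : G.edgeSet) : ∀ᵐ t ∂ρ e, 0 < t := by
    filter_upwards [show ∀ᵐ t ∂ρ e, t ∈ Set.Icc lam⁻¹ lam from hρsupp e] with t ht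
    exact hlam0.trans_le ht.1
  set ρH : H.edgeSet → Measure ℝ := fun e => ρ ⟨e.1, H.edgeSet_subset e.2⟩
  set ρR : {e : G.edgeSet // e.1 ∉ H.edgeSet} → Measure ℝ := fun e => ρ e.1
  set p : (H.edgeSet → ℝ) → ENNReal :=
    fun c => ENNReal.ofReal (ZH * (Real.sqrt (gdet H.coe (subCond H c) {v₀'}))⁻¹) with hp
  set q : (G.edgeSet → ℝ) → ENNReal :=
    fun c => ENNReal.ofReal (Z * (Real.sqrt (gdet G (extendE G c) {v₀}))⁻¹) with hq
  set φ : (H.edgeSet → ℝ) → ENNReal := fun c => ENNReal.ofReal (f c + C) with hφ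
  have hpm : Measurable p := by
    have : Measurable fun c : H.edgeSet → ℝ => gdet H.coe (subCond H c) {v₀'} := by
      refine (continuous_gdet H.coe (subCond H) (continuous_pi fun e => ?_) _).measurable
      unfold subCond
      split_ifs <;> fun_prop
    fun_prop
  have hqm : Measurable q := by
    have : Measurable fun c : G.edgeSet → ℝ => gdet G (extendE G c) {v₀} := by
      refine (continuous_gdet G (extendE G) (continuous_pi fun e => ?_) _).measurable
      unfold extendE
      split_ifs <;> fun_prop
    fun_prop
  have hφm : Measurable φ := by fun_prop
  have hrm : Measurable (restrictConfig H) :=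
    measurable_pi_lambda _ fun e => measurable_pi_apply _
  have hjm := measurable_joinConfig H
  have hjym (y : {e : G.edgeSet // e.1 ∉ H.edgeSet} → ℝ) :
      Measurable fun x => q (joinConfig H x y) :=
    hqm.comp (hjm.comp (measurable_id.prodMk measurable_const))
  set S : Set (H.edgeSet → ℝ) := Set.univ.pi fun _ => Set.Ioi 0 with hS
  have hSm : MeasurableSet S := MeasurableSet.univ_pi fun _ => measurableSet_Ioi
  have hmemS (x : H.edgeSet → ℝ) : x ∈ S ↔ ∀ e, 0 < x e := by simp [hS]
  have hSind (g : (H.edgeSet → ℝ) → ENNReal) :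
      ∫⁻ x, S.indicator g x ∂Measure.pi ρH = ∫⁻ x, g x ∂Measure.pi ρH := by
    rw [lintegral_indicator hSm, Measure.restrict_eq_self_of_ae_mem]
    filter_upwards [ae_pi_forall_pos ρH fun e => hρpos _] with x hx
    exact (hmemS x).2 hx
  have hpq (x x' : H.edgeSet → ℝ) (y : {e : G.edgeSet // e.1 ∉ H.edgeSet} → ℝ) (hx : ∀ e, 0 < x e)
      (hx' : ∀ e, 0 < x' e) (hy : ∀ e, 0 < y e) :
      p x * q (joinConfig H x' y) ≤ q (joinConfig H (x ⊔ x') y) * p (x ⊓ x') := by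
    have hjpos (x : H.edgeSet → ℝ) (hx : ∀ e, 0 < x e) (e : G.edgeSet) :
        0 < joinConfig H x y e := by
      unfold joinConfig
      split_ifs
      exacts [hx _, hy _]
    have hGpos (x : H.edgeSet → ℝ) (hx : ∀ e, 0 < x e) :
        0 < gdet G (extendE G (joinConfig H x y)) {v₀} :=
      gdet_pos_s11 G hconn _ (fun a b h => by
        rw [extendE, dif_pos (show s(a, b) ∈ G.edgeSet from h)]
        exact hjpos x hx _) _
    have hHpos (x : H.edgeSet → ℝ) (hx : ∀ e, 0 < x e) :
        0 < gdet H.coe (subCond H x) {v₀'} :=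
      gdet_pos_s11 H.coe hHconn.coe _ (fun a b h => by
        rw [subCond, dif_pos (show Sym2.map Subtype.val s(a, b) ∈ H.edgeSet from h)]
        exact hx _) _
    have hinf : ∀ e, 0 < (x ⊓ x') e := fun e => lt_inf_iff.2 ⟨hx e, hx' e⟩
    have hsup : ∀ e, 0 < (x ⊔ x') e := fun e => lt_sup_iff.2 (.inl (hx e))
    have hdet := gdet_mul_gdet_le H hconn hHconn v₀ v₀' (x ⊓ x') x (joinConfig H x' y)
      (joinConfig H (x ⊔ x') y) hinf (hjpos x' hx')
      (by rw [restrictConfig_joinConfig]; exact inf_le_right) inf_le_left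
      (fun e => by
        rw [restrictConfig_joinConfig, restrictConfig_joinConfig]
        have := inf_add_sup (x e) (x' e)
        simp only [Pi.sup_apply, Pi.inf_apply]
        linarith)
      (fun e he => by rw [joinConfig_of_notMem H _ _ e he, joinConfig_of_notMem H _ _ e he])
    rw [hp, hq]
    dsimp only
    rw [← ENNReal.ofReal_mul (by positivity), ← ENNReal.ofReal_mul (by positivity)]
    refine ENNReal.ofReal_le_ofReal ?_
    have hsqrt := Real.sqrt_le_sqrt hdet
    rw [Real.sqrt_mul (hHpos _ hinf).le, Real.sqrt_mul (hHpos _ hx).le] at hsqrt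
    have hpos := mul_pos (Real.sqrt_pos.2 (hHpos _ hinf)) (Real.sqrt_pos.2 (hGpos _ hsup))
    have hinv := mul_le_mul_of_nonneg_left (inv_anti₀ hpos hsqrt) (mul_pos hZ hZH).le
    rw [mul_inv, mul_inv] at hinv
    linarith
  have hfiber (y : {e : G.edgeSet // e.1 ∉ H.edgeSet} → ℝ) (hy : ∀ e, 0 < y e) :
      (∫⁻ x, p x * φ x ∂Measure.pi ρH) * ∫⁻ x, q (joinConfig H x y) ∂Measure.pi ρH ≤
        (∫⁻ x, q (joinConfig H x y) * φ x ∂Measure.pi ρH) * ∫⁻ x, p x ∂Measure.pi ρH := by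
    have key := lintegral_pi_mul_lintegral_pi_le_of_sup_inf ρH
      ((show Measurable fun x => p x * φ x from hpm.mul hφm).indicator hSm)
      ((hjym y).indicator hSm)
      ((show Measurable fun x => q (joinConfig H x y) * φ x from (hjym y).mul hφm).indicator hSm)
      (hpm.indicator hSm) fun x x' => by
        by_cases hx : x ∈ S
        swap
        · simp [Set.indicator_of_notMem hx]
        by_cases hx' : x' ∈ S
        swap
        · simp [Set.indicator_of_notMem hx']
        have hx0 := (hmemS x).1 hx
        have hx0' := (hmemS x').1 hx'
        have hsup : ∀ e, 0 < (x ⊔ x') e := fun e => lt_sup_iff.2 (.inl (hx0 e))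
        have hinf : ∀ e, 0 < (x ⊓ x') e := fun e => lt_inf_iff.2 ⟨hx0 e, hx0' e⟩
        rw [Set.indicator_of_mem hx, Set.indicator_of_mem hx',
          Set.indicator_of_mem ((hmemS _).2 hsup), Set.indicator_of_mem ((hmemS _).2 hinf)]
        have hφle : φ x ≤ φ (x ⊔ x') :=
          ENNReal.ofReal_le_ofReal (by linarith [hfmono x (x ⊔ x') hx0 hsup le_sup_left])
        calc p x * φ x * q (joinConfig H x' y) = p x * q (joinConfig H x' y) * φ x := by ring
          _ ≤ q (joinConfig H (x ⊔ x') y) * p (x ⊓ x') * φ (x ⊔ x') :=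
            mul_le_mul' (hpq x x' y hx0 hx0' hy) hφle
          _ = q (joinConfig H (x ⊔ x') y) * φ (x ⊔ x') * p (x ⊓ x') := by ring
    simpa only [hSind] using key
  have hsplit (g : (G.edgeSet → ℝ) → ENNReal) (hg : Measurable g) :
      ∫⁻ c, g c ∂Measure.pi ρ =
        ∫⁻ y, ∫⁻ x, g (joinConfig H x y) ∂Measure.pi ρH ∂Measure.pi ρR := by
    rw [← map_joinConfig_prod H ρ, lintegral_map hg hjm]
    exact lintegral_prod_symm' _ (hg.comp hjm)
  have hp1 : ∫⁻ x, p x ∂Measure.pi ρH = 1 := by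
    have h := measure_univ (μ := μH)
    rwa [hμH, withDensity_apply _ MeasurableSet.univ, Measure.restrict_univ] at h
  have hq1 : ∫⁻ y, ∫⁻ x, q (joinConfig H x y) ∂Measure.pi ρH ∂Measure.pi ρR = 1 := by
    have h := measure_univ (μ := μG)
    rwa [hμG, withDensity_apply _ MeasurableSet.univ, Measure.restrict_univ, hsplit q hqm] at h
  have hmain : ∫⁻ c, ENNReal.ofReal (f c + C) ∂μH ≤
      ∫⁻ c, ENNReal.ofReal (f (restrictConfig H c) + C) ∂μG := by
    have hqym : Measurable fun y => ∫⁻ x, q (joinConfig H x y) ∂Measure.pi ρH :=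
      (hqm.comp hjm).lintegral_prod_left'
    have hφrm : Measurable fun c => ENNReal.ofReal (f (restrictConfig H c) + C) := hφm.comp hrm
    rw [hμH, hμG, lintegral_withDensity_eq_lintegral_mul _ hpm hφm,
      lintegral_withDensity_eq_lintegral_mul _ hqm hφrm,
      hsplit _ (hqm.mul hφrm)]
    calc ∫⁻ x, p x * φ x ∂Measure.pi ρH
        = ∫⁻ y, (∫⁻ x, p x * φ x ∂Measure.pi ρH) *
            ∫⁻ x, q (joinConfig H x y) ∂Measure.pi ρH ∂Measure.pi ρR := by
          rw [lintegral_const_mul _ hqym, hq1, mul_one]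
      _ ≤ ∫⁻ y, ∫⁻ x, q (joinConfig H x y) * φ x ∂Measure.pi ρH ∂Measure.pi ρR := by
          refine lintegral_mono_ae ?_
          filter_upwards [ae_pi_forall_pos ρR fun e => hρpos _] with y hy
          simpa only [hp1, mul_one] using hfiber y hy
      _ = _ := by
          refine lintegral_congr fun y => lintegral_congr fun x => ?_
          simp only [Pi.mul_apply, restrictConfig_joinConfig, hφ]
  have hintH : Integrable f μH :=
    .of_bound hfmeas.aestronglyMeasurable C (.of_forall hC)
  have hintG : Integrable (fun c => f (restrictConfig H c)) μG :=
    .of_bound (hfmeas.comp hrm).aestronglyMeasurable C (.of_forall fun _ => hC _)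
  have hnn (c : H.edgeSet → ℝ) : 0 ≤ f c + C := by linarith [neg_le_of_abs_le (hC c)]
  rw [← ofReal_integral_eq_lintegral_ofReal (f := fun c => f c + C)
      (hintH.add (integrable_const C)) (.of_forall hnn),
    ← ofReal_integral_eq_lintegral_ofReal (f := fun c => f (restrictConfig H c) + C)
      (hintG.add (integrable_const C))
      (.of_forall fun _ => hnn _),
    ENNReal.ofReal_le_ofReal_iff (integral_nonneg fun _ => hnn _),
    integral_add hintH (integrable_const C), integral_add hintG (integrable_const C)] at hmain
  simpa using hmain
end
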